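/- arXiv:1511.07310 — 5 statements merged into one kernel-verified Lean document; each statement's English description precedes it below -/
import Mathlib

section
/- Let G be a finite simple graph and let H_1 and H_2 be subgraphs of G whose vertex sets have exactly one element x in common and such that G = H_1 ∪ H_2. Suppose that x belongs to every maximum minimal vertex cover of H_1 and to every maximum minimal vertex cover of H_2. Let D_1 and D_2 be maximum minimal vertex covers of H_1 and H_2, respectively. Then D_1 ∪ D_2 is a maximum minimal vertex cover of G, and x belongs to every maximum minimal vertex cover of G. -/
open SimpleGraph

variable {V : Type}

/-- `C` is a vertex cover of `G`: every edge of `G` has an endpoint in `C`. -/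
def IsVC (G : SimpleGraph V) (C : Set V) : Prop :=
  ∀ ⦃u v : V⦄, G.Adj u v → u ∈ C ∨ v ∈ C

/-- `C` is a minimal vertex cover of `G`. -/
def IsMinVC (G : SimpleGraph V) (C : Set V) : Prop :=
  IsVC G C ∧ ∀ D : Set V, D ⊂ C → ¬ IsVC G D

/-- `C` is a maximum minimal vertex cover of `G`: a minimal vertex cover of
maximal cardinality among minimal vertex covers. -/
def IsMaxMinVC (G : SimpleGraph V) (C : Set V) : Prop :=
  IsMinVC G C ∧ ∀ D : Set V, IsMinVC G D → D.ncard ≤ C.ncard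

/-- The big height of the edge ideal of `G`: the maximum cardinality of a
minimal vertex cover of `G`. -/
noncomputable def bight (G : SimpleGraph V) : ℕ :=
  sSup {n : ℕ | ∃ C : Set V, IsMinVC G C ∧ C.ncard = n}

theorem isMinVC_iff (G : SimpleGraph V) (C : Set V) :
    IsMinVC G C ↔ IsVC G C ∧ ∀ v ∈ C, ∃ w, w ∉ C ∧ G.Adj v w := by
  constructor
  · rintro ⟨h, hm⟩
    refine ⟨h, fun v hv => ?_⟩
    by_contra hcon
    push Not at hcon
    refine hm (C \ {v}) ⟨Set.diff_subset, fun hh => (hh hv).2 rfl⟩ ?_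
    intro a b hab
    by_cases ha : a = v
    · subst ha
      right
      refine ⟨?_, fun hb => hab.ne hb.symm⟩
      by_contra hb
      exact hcon b hb hab
    · by_cases hb : b = v
      · subst hb
        left
        refine ⟨?_, ha⟩
        by_contra ha'
        exact hcon a ha' hab.symm
      · exact (h hab).imp (fun h => ⟨h, ha⟩) (fun h => ⟨h, hb⟩)
  · rintro ⟨h, hp⟩
    refine ⟨h, fun D hD hvc => ?_⟩
    obtain ⟨v, hv, hvD⟩ := Set.exists_of_ssubset hD
    obtain ⟨w, hw, hvw⟩ := hp v hv
    rcases hvc hvw with h1 | h1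
    · exact hvD h1
    · exact hw (hD.1 h1)

theorem bound_side [Fintype V] (H : SimpleGraph V) (x : V) (D C : Set V)
    (hD : IsMaxMinVC H D) (hx : ∀ C : Set V, IsMaxMinVC H C → x ∈ C)
    (hC : IsVC H C) (hp : ∀ v ∈ C, v ∈ H.support → v ≠ x → ∃ w, w ∉ C ∧ H.Adj v w) :
    ((C ∩ H.support) \ {x}).ncard + 1 ≤ D.ncard := by
  have hvc : IsVC H (C ∩ H.support) := fun a b hab =>
    (hC hab).imp (fun h => ⟨h, b, hab⟩) (fun h => ⟨h, a, hab.symm⟩)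
  have key : ∀ E : Set V, IsMinVC H E → x ∉ E → E.ncard + 1 ≤ D.ncard := by
    intro E hE hxE
    by_contra hlt
    have h1 := hD.2 E hE
    exact hxE (hx E ⟨hE, fun F hF => (hD.2 F hF).trans (by omega)⟩)
  by_cases hpx : ∃ w, w ∉ C ∧ H.Adj x w
  · have hm : IsMinVC H (C ∩ H.support) := by
      rw [isMinVC_iff]
      refine ⟨hvc, fun v hv => ?_⟩
      have : ∃ w, w ∉ C ∧ H.Adj v w := by
        by_cases hvx : v = x
        · rw [hvx]; exact hpx
        · exact hp v hv.1 hv.2 hvx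
      obtain ⟨w, hw, hvw⟩ := this
      exact ⟨w, fun h => hw h.1, hvw⟩
    by_cases hxE : x ∈ C ∩ H.support
    · rw [Set.ncard_diff_singleton_add_one hxE]
      exact hD.2 _ hm
    · rw [Set.diff_singleton_eq_self hxE]
      exact key _ hm hxE
  · push Not at hpx
    refine key _ ?_ (fun h => h.2 rfl)
    rw [isMinVC_iff]
    constructor
    · intro a b hab
      by_cases ha : a = x
      · subst ha
        right
        refine ⟨⟨?_, a, hab.symm⟩, fun hb => hab.ne hb.symm⟩
        by_contra hb
        exact hpx b hb hab
      · by_cases hb : b = x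
        · subst hb
          left
          refine ⟨⟨?_, b, hab⟩, ha⟩
          by_contra ha'
          exact hpx a ha' hab.symm
        · exact (hvc hab).imp (fun h => ⟨h, ha⟩) (fun h => ⟨h, hb⟩)
    · intro v hv
      obtain ⟨w, hw, hvw⟩ := hp v hv.1.1 hv.1.2 hv.2
      exact ⟨w, fun h => hw h.1.1, hvw⟩

/-- If `G = H₁ ∪ H₂` where the vertex sets of `H₁` and `H₂` meet exactly in
`{x}`, and `x` belongs to every maximum minimal vertex cover of `H₁` and of
`H₂`, then the union of maximum minimal vertex covers `D₁` of `H₁` and `D₂`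
of `H₂` is a maximum minimal vertex cover of `G`, and `x` belongs to every
maximum minimal vertex cover of `G`. -/
theorem stmt8 {V : Type} [Fintype V] (G H₁ H₂ : SimpleGraph V) (x : V)
    (hG : G = H₁ ⊔ H₂) (hsup : H₁.support ∩ H₂.support = {x})
    (hx₁ : ∀ C : Set V, IsMaxMinVC H₁ C → x ∈ C)
    (hx₂ : ∀ C : Set V, IsMaxMinVC H₂ C → x ∈ C)
    (D₁ D₂ : Set V) (hD₁ : IsMaxMinVC H₁ D₁) (hD₂ : IsMaxMinVC H₂ D₂) :
    IsMaxMinVC G (D₁ ∪ D₂) ∧ ∀ C : Set V, IsMaxMinVC G C → x ∈ C := by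
  subst hG
  have hxs : ∀ v, v ∈ H₁.support → v ∈ H₂.support → v = x := fun v h1 h2 => by
    have : v ∈ H₁.support ∩ H₂.support := ⟨h1, h2⟩
    rw [hsup] at this
    exact this
  have m1 := (isMinVC_iff _ _).1 hD₁.1
  have m2 := (isMinVC_iff _ _).1 hD₂.1
  have x1 := hx₁ _ hD₁
  have x2 := hx₂ _ hD₂
  have s1 : ∀ v ∈ D₁, v ∈ H₁.support := fun v hv => by
    obtain ⟨w, _, h⟩ := m1.2 v hv
    exact ⟨w, h⟩
  have s2 : ∀ v ∈ D₂, v ∈ H₂.support := fun v hv => by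
    obtain ⟨w, _, h⟩ := m2.2 v hv
    exact ⟨w, h⟩
  have hmin : IsMinVC (H₁ ⊔ H₂) (D₁ ∪ D₂) := by
    rw [isMinVC_iff]
    constructor
    · rintro a b (h | h)
      · exact (m1.1 h).imp Or.inl Or.inl
      · exact (m2.1 h).imp Or.inr Or.inr
    · rintro v (hv | hv)
      · obtain ⟨w, hw, h⟩ := m1.2 v hv
        refine ⟨w, ?_, Or.inl h⟩
        rintro (h' | h')
        · exact hw h'
        · exact hw (hxs w ⟨v, h.symm⟩ (s2 w h') ▸ x1)
      · obtain ⟨w, hw, h⟩ := m2.2 v hv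
        refine ⟨w, ?_, Or.inr h⟩
        rintro (h' | h')
        · exact hw (hxs w (s1 w h') ⟨v, h.symm⟩ ▸ x2)
        · exact hw h'
  have hcard : (D₁ ∪ D₂).ncard + 1 = D₁.ncard + D₂.ncard := by
    have hi : D₁ ∩ D₂ = {x} := by
      ext v
      constructor
      · rintro ⟨h1, h2⟩
        exact hxs v (s1 v h1) (s2 v h2)
      · rintro rfl
        exact ⟨x1, x2⟩
    have := Set.ncard_union_add_ncard_inter D₁ D₂
    rwa [hi, Set.ncard_singleton] at this
  have bd : ∀ C : Set V, IsMinVC (H₁ ⊔ H₂) C → (C \ {x}).ncard + 2 ≤ D₁.ncard + D₂.ncard := by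
    intro C hC
    have m := (isMinVC_iff _ _).1 hC
    have b1 := bound_side H₁ x D₁ C hD₁ hx₁ (fun a b h => m.1 (Or.inl h)) (by
      intro v hv hs hne
      obtain ⟨w, hw, h | h⟩ := m.2 v hv
      · exact ⟨w, hw, h⟩
      · exact absurd (hxs v hs ⟨w, h⟩) hne)
    have b2 := bound_side H₂ x D₂ C hD₂ hx₂ (fun a b h => m.1 (Or.inr h)) (by
      intro v hv hs hne
      obtain ⟨w, hw, h | h⟩ := m.2 v hv
      · exact absurd (hxs v ⟨w, h⟩ hs) hne
      · exact ⟨w, hw, h⟩)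
    have hsub : C \ {x} ⊆ ((C ∩ H₁.support) \ {x}) ∪ ((C ∩ H₂.support) \ {x}) := by
      rintro v ⟨hv, hne⟩
      obtain ⟨w, hw, h | h⟩ := m.2 v hv
      · exact Or.inl ⟨⟨hv, w, h⟩, hne⟩
      · exact Or.inr ⟨⟨hv, w, h⟩, hne⟩
    have c1 := Set.ncard_le_ncard hsub (Set.toFinite _)
    have c2 := Set.ncard_union_le ((C ∩ H₁.support) \ {x}) ((C ∩ H₂.support) \ {x})
    omega
  refine ⟨⟨hmin, fun C hC => ?_⟩, fun C hC => ?_⟩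
  · have := bd C hC
    by_cases hx : x ∈ C
    · have := Set.ncard_diff_singleton_add_one hx
      omega
    · rw [Set.diff_singleton_eq_self hx] at this
      omega
  · by_contra hx
    have h1 := bd C hC.1
    have h2 := hC.2 _ hmin
    rw [Set.diff_singleton_eq_self hx] at h1
    omega
end

section
/- Let G be a finite simple graph formed by two vertex-disjoint subgraphs H_1 and H_2 connected through an edge x_1x_2, where x_1 is a vertex of H_1 and x_2 is a vertex of H_2 (so G = H_1 ∪ {x_1x_2} ∪ H_2). For i = 1,2 let D_i be a maximum minimal vertex cover of H_i and set H_i' = H_i ∪ {x_1x_2}. Suppose x_1 ∈ D_1 and that, for i = 1,2, x_i belongs to no maximum minimal vertex cover of H_i'. Then D_1 ∪ D_2 is a maximum minimal vertex cover of G. -/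
open SimpleGraph

variable {V : Type}

theorem aux_iff {V : Type} (G : SimpleGraph V) (C : Set V) :
    IsMinVC G C ↔ IsVC G C ∧ ∀ c ∈ C, ∃ w, w ∉ C ∧ G.Adj c w := by
  constructor
  · rintro ⟨h, hm⟩
    refine ⟨h, fun c hc => ?_⟩
    by_contra hcon
    push Not at hcon
    refine hm (C \ {c}) ⟨Set.diff_subset, fun hh => (hh hc).2 rfl⟩ ?_
    intro u v huv
    have hne := huv.ne
    have h1 := h huv
    have h2 := hcon u
    have h3 := hcon v
    have h4 := huv.symm
    simp only [Set.mem_diff, Set.mem_singleton_iff]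
    by_cases hu : u = c
    · subst hu
      right
      exact ⟨by by_contra hv; exact h3 hv huv, fun e => hne e.symm⟩
    · by_cases hv : v = c
      · subst hv
        left
        exact ⟨by by_contra hv; exact h2 hv h4, hne⟩
      · tauto
  · rintro ⟨h, hm⟩
    refine ⟨h, fun D hD hDv => ?_⟩
    obtain ⟨c, hc, hcD⟩ := Set.exists_of_ssubset hD
    obtain ⟨w, hw, hcw⟩ := hm c hc
    rcases hDv hcw with h1 | h1
    · exact hcD h1
    · exact hw (hD.1 h1)

theorem aux_exists {V : Type} [Fintype V] (K : SimpleGraph V) (C : Set V) (hC : IsMinVC K C) :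
    ∃ E, IsMaxMinVC K E := by
  obtain ⟨E, hE, hm⟩ := Set.exists_max_image {E : Set V | IsMinVC K E} Set.ncard
    (Set.toFinite _) ⟨C, hC⟩
  exact ⟨E, hE, hm⟩

theorem aux_side {V : Type} [Fintype V] (G H L K : SimpleGraph V) (x y : V)
    (hdisj : Disjoint H.support L.support)
    (hx : x ∈ H.support) (hy : y ∈ L.support)
    (hG : ∀ u v, G.Adj u v ↔ H.Adj u v ∨ (u = x ∧ v = y) ∨ (u = y ∧ v = x) ∨ L.Adj u v)
    (hK : ∀ u v, K.Adj u v ↔ H.Adj u v ∨ (u = x ∧ v = y) ∨ (u = y ∧ v = x))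
    (D : Set V) (hD : IsMaxMinVC H D)
    (h : ∀ C : Set V, IsMaxMinVC K C → x ∉ C)
    (C : Set V) (hC : IsMinVC G C) : (C ∩ H.support).ncard ≤ D.ncard := by
  have hs : ∀ u v, H.Adj u v → u ∈ H.support ∧ v ∈ H.support := fun u v huv =>
    ⟨⟨v, huv⟩, ⟨u, huv.symm⟩⟩
  have hls : ∀ u v, L.Adj u v → u ∉ H.support := fun u v huv hu =>
    Set.disjoint_left.1 hdisj hu ⟨v, huv⟩
  have hyH : y ∉ H.support := fun hh => Set.disjoint_left.1 hdisj hh hy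
  obtain ⟨hv, hp⟩ := (aux_iff G C).1 hC
  have hcov : IsVC H (C ∩ H.support) := by
    intro u v huv
    have := hs u v huv
    rcases hv ((hG u v).2 (Or.inl huv)) with h1 | h1
    · exact Or.inl ⟨h1, this.1⟩
    · exact Or.inr ⟨h1, this.2⟩
  by_cases hmin : IsMinVC H (C ∩ H.support)
  · exact hD.2 _ hmin
  have hxC : x ∈ C := by
    by_contra hxC
    refine hmin ((aux_iff _ _).2 ⟨hcov, ?_⟩)
    rintro c ⟨hc, hcs⟩
    obtain ⟨w, hw, hcw⟩ := hp c hc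
    rcases (hG c w).1 hcw with h1 | ⟨h1, _⟩ | ⟨h1, _⟩ | h1
    · exact ⟨w, fun hh => hw hh.1, h1⟩
    · exact absurd (h1 ▸ hc) hxC
    · exact absurd (h1 ▸ hcs) hyH
    · exact absurd hcs (hls _ _ h1)
  have hKmin : IsMinVC K (C ∩ H.support) := by
    refine (aux_iff _ _).2 ⟨?_, ?_⟩
    · intro u v huv
      rcases (hK u v).1 huv with h1 | ⟨h1, _⟩ | ⟨_, h1⟩
      · exact hcov h1
      · left; rw [h1]; exact ⟨hxC, hx⟩
      · right; rw [h1]; exact ⟨hxC, hx⟩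
    · rintro c ⟨hc, hcs⟩
      obtain ⟨w, hw, hcw⟩ := hp c hc
      refine ⟨w, fun hh => hw hh.1, (hK _ _).2 ?_⟩
      rcases (hG c w).1 hcw with h1 | h1 | h1 | h1
      · exact Or.inl h1
      · exact Or.inr (Or.inl h1)
      · exact Or.inr (Or.inr h1)
      · exact absurd hcs (hls _ _ h1)
  obtain ⟨E, hE⟩ := aux_exists K _ hKmin
  have hxE := h E hE
  have hlt : (C ∩ H.support).ncard < E.ncard := by
    refine lt_of_le_of_ne (hE.2 _ hKmin) fun heq => ?_
    exact h _ ⟨hKmin, fun D' hD' => heq ▸ hE.2 D' hD'⟩ ⟨hxC, hx⟩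
  obtain ⟨hEv, hEp⟩ := (aux_iff K E).1 hE.1
  have hyE : y ∈ E := (hEv ((hK x y).2 (Or.inr (Or.inl ⟨rfl, rfl⟩)))).resolve_left hxE
  have hE' : IsMinVC H (E \ {y}) := by
    refine (aux_iff _ _).2 ⟨?_, ?_⟩
    · intro u v huv
      have := hs u v huv
      rcases hEv ((hK u v).2 (Or.inl huv)) with h1 | h1
      · exact Or.inl ⟨h1, fun e => hyH (e ▸ this.1)⟩
      · exact Or.inr ⟨h1, fun e => hyH (e ▸ this.2)⟩
    · rintro c ⟨hc, hcy⟩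
      obtain ⟨w, hw, hcw⟩ := hEp c hc
      refine ⟨w, fun hh => hw hh.1, ?_⟩
      rcases (hK c w).1 hcw with h1 | ⟨h1, _⟩ | ⟨h1, _⟩
      · exact h1
      · exact absurd (h1 ▸ hc) hxE
      · exact absurd h1 hcy
  have h5 := hD.2 _ hE'
  have h6 := Set.ncard_diff_singleton_add_one hyE (Set.toFinite E)
  omega

theorem stmt9 {V : Type} [Fintype V] (G H₁ H₂ : SimpleGraph V) (x₁ x₂ : V)
    (hdisj : Disjoint H₁.support H₂.support)
    (hx₁ : x₁ ∈ H₁.support) (hx₂ : x₂ ∈ H₂.support)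
    (hG : G = H₁ ⊔ SimpleGraph.fromEdgeSet {s(x₁, x₂)} ⊔ H₂)
    (D₁ D₂ : Set V) (hD₁ : IsMaxMinVC H₁ D₁) (hD₂ : IsMaxMinVC H₂ D₂)
    (hx₁D₁ : x₁ ∈ D₁)
    (h₁ : ∀ C : Set V,
      IsMaxMinVC (H₁ ⊔ SimpleGraph.fromEdgeSet {s(x₁, x₂)}) C → x₁ ∉ C)
    (h₂ : ∀ C : Set V,
      IsMaxMinVC (H₂ ⊔ SimpleGraph.fromEdgeSet {s(x₁, x₂)}) C → x₂ ∉ C) :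
    IsMaxMinVC G (D₁ ∪ D₂) := by
  have hne : x₁ ≠ x₂ := fun e => Set.disjoint_left.1 hdisj hx₁ (e ▸ hx₂)
  have he : ∀ u v, (SimpleGraph.fromEdgeSet {s(x₁, x₂)}).Adj u v ↔
      (u = x₁ ∧ v = x₂) ∨ (u = x₂ ∧ v = x₁) := by
    intro u v
    simp only [SimpleGraph.fromEdgeSet_adj, Set.mem_singleton_iff, Sym2.eq_iff]
    constructor
    · exact fun hh => hh.1
    · rintro (⟨rfl, rfl⟩ | ⟨rfl, rfl⟩)
      · exact ⟨Or.inl ⟨rfl, rfl⟩, hne⟩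
      · exact ⟨Or.inr ⟨rfl, rfl⟩, hne.symm⟩
  have hGa : ∀ u v, G.Adj u v ↔
      H₁.Adj u v ∨ (u = x₁ ∧ v = x₂) ∨ (u = x₂ ∧ v = x₁) ∨ H₂.Adj u v := by
    intro u v
    rw [hG, SimpleGraph.sup_adj, SimpleGraph.sup_adj, he]
    tauto
  obtain ⟨hv1, hp1⟩ := (aux_iff _ _).1 hD₁.1
  obtain ⟨hv2, hp2⟩ := (aux_iff _ _).1 hD₂.1
  have hs1 : D₁ ⊆ H₁.support := fun c hc => by
    obtain ⟨w, _, hw⟩ := hp1 c hc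
    exact ⟨w, hw⟩
  have hs2 : D₂ ⊆ H₂.support := fun c hc => by
    obtain ⟨w, _, hw⟩ := hp2 c hc
    exact ⟨w, hw⟩
  refine ⟨(aux_iff _ _).2 ⟨?_, ?_⟩, ?_⟩
  · intro u v huv
    rcases (hGa u v).1 huv with h | ⟨h, _⟩ | ⟨_, h⟩ | h
    · exact (hv1 h).imp Or.inl Or.inl
    · exact Or.inl (Or.inl (h ▸ hx₁D₁))
    · exact Or.inr (Or.inl (h ▸ hx₁D₁))
    · exact (hv2 h).imp Or.inr Or.inr
  · rintro c (hc | hc)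
    · obtain ⟨w, hw, hcw⟩ := hp1 c hc
      refine ⟨w, ?_, (hGa _ _).2 (Or.inl hcw)⟩
      rintro (h | h)
      · exact hw h
      · exact Set.disjoint_left.1 hdisj ⟨c, hcw.symm⟩ (hs2 h)
    · obtain ⟨w, hw, hcw⟩ := hp2 c hc
      refine ⟨w, ?_, (hGa _ _).2 (Or.inr (Or.inr (Or.inr hcw)))⟩
      rintro (h | h)
      · exact Set.disjoint_left.1 hdisj (hs1 h) ⟨c, hcw.symm⟩
      · exact hw h
  · intro C hC
    have a1 := aux_side G H₁ H₂ _ x₁ x₂ hdisj hx₁ hx₂ hGa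
      (fun u v => by rw [SimpleGraph.sup_adj, he]) D₁ hD₁ h₁ C hC
    have a2 := aux_side G H₂ H₁ _ x₂ x₁ hdisj.symm hx₂ hx₁
      (fun u v => by rw [hGa]; tauto)
      (fun u v => by rw [SimpleGraph.sup_adj, he]; tauto) D₂ hD₂ h₂ C hC
    have hsub : C ⊆ (C ∩ H₁.support) ∪ (C ∩ H₂.support) := by
      intro c hc
      obtain ⟨w, _, hw⟩ := ((aux_iff _ _).1 hC).2 c hc
      rcases (hGa c w).1 hw with h | ⟨h, _⟩ | ⟨h, _⟩ | h
      · exact Or.inl ⟨hc, ⟨w, h⟩⟩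
      · exact Or.inl ⟨hc, h ▸ hx₁⟩
      · exact Or.inr ⟨hc, h ▸ hx₂⟩
      · exact Or.inr ⟨hc, ⟨w, h⟩⟩
    have b1 := Set.ncard_le_ncard hsub (Set.toFinite _)
    have b2 := Set.ncard_union_le (C ∩ H₁.support) (C ∩ H₂.support)
    have b3 := Set.ncard_union_eq (hdisj.mono hs1 hs2) (Set.toFinite D₁) (Set.toFinite D₂)
    omega
end

section
/- Let G be a finite simple graph formed by two vertex-disjoint subgraphs H_1 and H_2 connected through an edge x_1x_2, where x_1 is a vertex of H_1 and x_2 is a vertex of H_2 (so G = H_1 ∪ {x_1x_2} ∪ H_2). For i = 1,2 let D_i be a maximum minimal vertex cover of H_i. Suppose that x_1 belongs to every maximum minimal vertex cover of H_1. Then D_1 ∪ D_2 is a maximum minimal vertex cover of G. -/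
open SimpleGraph

variable {V : Type}

theorem isMinVC_iff_private {V : Type} (G : SimpleGraph V) (C : Set V) :
    IsMinVC G C ↔ IsVC G C ∧ ∀ v ∈ C, ∃ w, G.Adj v w ∧ w ∉ C := by
  constructor
  · rintro ⟨h, hm⟩
    refine ⟨h, fun v hv => ?_⟩
    by_contra hcon
    push Not at hcon
    refine hm (C \ {v}) ⟨Set.diff_subset, fun hs => (hs hv).2 rfl⟩ ?_
    intro a b hab
    have hne := hab.ne
    by_cases ha : a = v
    · subst ha
      exact Or.inr ⟨hcon b hab, fun hb => hne hb.symm⟩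
    · by_cases hb : b = v
      · subst hb
        exact Or.inl ⟨hcon a hab.symm, ha⟩
      · rcases h hab with h | h
        · exact Or.inl ⟨h, ha⟩
        · exact Or.inr ⟨h, hb⟩
  · rintro ⟨h, hp⟩
    refine ⟨h, fun D hD hc => ?_⟩
    obtain ⟨v, hv, hvD⟩ := Set.exists_of_ssubset hD
    obtain ⟨w, hw, hwC⟩ := hp v hv
    rcases hc hw with h | h
    · exact hvD h
    · exact hwC (hD.1 h)

/-- Either `C` is minimal, or `x` has no private neighbour and `C \ {x}` is minimal. -/
theorem isMinVC_or_erase {V : Type} (H : SimpleGraph V) (C : Set V) (x : V)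
    (h : IsVC H C) (hp : ∀ v ∈ C, v ≠ x → ∃ w, H.Adj v w ∧ w ∉ C) :
    IsMinVC H C ∨ (x ∈ C ∧ (∀ w, H.Adj x w → w ∈ C) ∧ IsMinVC H (C \ {x})) := by
  by_cases hx : x ∈ C ∧ ∀ w, H.Adj x w → w ∈ C
  · refine Or.inr ⟨hx.1, hx.2, ?_⟩
    rw [isMinVC_iff_private]
    constructor
    · intro a b hab
      have hne := hab.ne
      by_cases ha : a = x
      · subst ha
        exact Or.inr ⟨hx.2 b hab, fun hb => hne hb.symm⟩
      · by_cases hb : b = x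
        · subst hb
          exact Or.inl ⟨hx.2 a hab.symm, ha⟩
        · rcases h hab with h | h
          · exact Or.inl ⟨h, ha⟩
          · exact Or.inr ⟨h, hb⟩
    · rintro v ⟨hv, hvx⟩
      obtain ⟨w, hw, hwC⟩ := hp v hv hvx
      exact ⟨w, hw, fun h => hwC h.1⟩
  · left
    rw [isMinVC_iff_private]
    refine ⟨h, fun v hv => ?_⟩
    by_cases hvx : v = x
    · subst hvx
      by_contra hcon
      push Not at hcon
      exact hx ⟨hv, hcon⟩
    · exact hp v hv hvx

/-- Let `G` be formed by the vertex-disjoint subgraphs `H₁` and `H₂` connected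
through the edge `x₁x₂`, and let `Dᵢ` be a maximum minimal vertex cover of
`Hᵢ`. If `x₁` belongs to every maximum minimal vertex cover of `H₁`, then
`D₁ ∪ D₂` is a maximum minimal vertex cover of `G`. -/
theorem stmt10 {V : Type} [Fintype V] (G H₁ H₂ : SimpleGraph V) (x₁ x₂ : V)
    (hdisj : Disjoint H₁.support H₂.support)
    (hx₁ : x₁ ∈ H₁.support) (hx₂ : x₂ ∈ H₂.support)
    (hG : G = H₁ ⊔ SimpleGraph.fromEdgeSet {s(x₁, x₂)} ⊔ H₂)
    (D₁ D₂ : Set V) (hD₁ : IsMaxMinVC H₁ D₁) (hD₂ : IsMaxMinVC H₂ D₂)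
    (h₁ : ∀ C : Set V, IsMaxMinVC H₁ C → x₁ ∈ C) :
    IsMaxMinVC G (D₁ ∪ D₂) := by
  classical
  have hd : ∀ v, v ∈ H₁.support → v ∈ H₂.support → False :=
    fun v a b => Set.disjoint_left.mp hdisj a b
  have sl : ∀ (H : SimpleGraph V) {a b}, H.Adj a b → a ∈ H.support := fun H a b h => ⟨b, h⟩
  have hne : x₁ ≠ x₂ := fun h => hd x₁ hx₁ (h ▸ hx₂)
  have hadj : ∀ a b, G.Adj a b ↔
      H₁.Adj a b ∨ H₂.Adj a b ∨ (a = x₁ ∧ b = x₂) ∨ (a = x₂ ∧ b = x₁) := by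
    intro a b
    subst hG
    simp only [sup_adj, fromEdgeSet_adj, Set.mem_singleton_iff, Sym2.eq_iff]
    constructor
    · tauto
    · rintro (h | h | ⟨rfl, rfl⟩ | ⟨rfl, rfl⟩)
      · tauto
      · tauto
      · tauto
      · have := hne.symm
        tauto
  have hx₁D := h₁ D₁ hD₁
  obtain ⟨hm₁, hM₁⟩ := hD₁
  obtain ⟨hm₂, hM₂⟩ := hD₂
  have hm₁' := (isMinVC_iff_private _ _).1 hm₁
  have hm₂' := (isMinVC_iff_private _ _).1 hm₂
  have hs₁ : ∀ v ∈ D₁, v ∈ H₁.support := fun v hv =>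
    let ⟨_, hw, _⟩ := hm₁'.2 v hv; sl _ hw
  have hs₂ : ∀ v ∈ D₂, v ∈ H₂.support := fun v hv =>
    let ⟨_, hw, _⟩ := hm₂'.2 v hv; sl _ hw
  refine ⟨(isMinVC_iff_private _ _).2 ⟨?_, ?_⟩, ?_⟩
  · intro a b hab
    rcases (hadj a b).1 hab with h | h | ⟨rfl, rfl⟩ | ⟨rfl, rfl⟩
    · exact (hm₁'.1 h).imp Or.inl Or.inl
    · exact (hm₂'.1 h).imp Or.inr Or.inr
    · exact Or.inl (Or.inl hx₁D)
    · exact Or.inr (Or.inl hx₁D)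
  · rintro v (hv | hv)
    · obtain ⟨w, hw, hwD⟩ := hm₁'.2 v hv
      exact ⟨w, (hadj _ _).2 (Or.inl hw), fun h => h.elim hwD
        fun h => hd w (sl _ hw.symm) (hs₂ w h)⟩
    · obtain ⟨w, hw, hwD⟩ := hm₂'.2 v hv
      exact ⟨w, (hadj _ _).2 (Or.inr (Or.inl hw)), fun h => h.elim
        (fun h => hd w (hs₁ w h) (sl _ hw.symm)) hwD⟩
  · intro D hD
    obtain ⟨hc, hp⟩ := (isMinVC_iff_private _ _).1 hD
    rw [Set.ncard_union_eq (Set.disjoint_left.2 fun v a b => hd v (hs₁ v a) (hs₂ v b))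
      (Set.toFinite _) (Set.toFinite _)]
    have hDe : D = (D ∩ H₁.support) ∪ (D ∩ H₂.support) := by
      ext v
      constructor
      · intro hv
        obtain ⟨w, hw, -⟩ := hp v hv
        rcases (hadj v w).1 hw with h | h | ⟨rfl, rfl⟩ | ⟨rfl, rfl⟩
        · exact Or.inl ⟨hv, sl _ h⟩
        · exact Or.inr ⟨hv, sl _ h⟩
        · exact Or.inl ⟨hv, hx₁⟩
        · exact Or.inr ⟨hv, hx₂⟩
      · rintro (h | h) <;> exact h.1
    have hcard : D.ncard = (D ∩ H₁.support).ncard + (D ∩ H₂.support).ncard := by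
      conv_lhs => rw [hDe]
      exact Set.ncard_union_eq (Set.disjoint_left.2 fun v a b => hd v a.2 b.2)
        (Set.toFinite _) (Set.toFinite _)
    have c₁ : IsVC H₁ (D ∩ H₁.support) := fun a b h =>
      (hc ((hadj a b).2 (Or.inl h))).imp (fun k => ⟨k, sl _ h⟩) (fun k => ⟨k, sl _ h.symm⟩)
    have c₂ : IsVC H₂ (D ∩ H₂.support) := fun a b h =>
      (hc ((hadj a b).2 (Or.inr (Or.inl h)))).imp
        (fun k => ⟨k, sl _ h⟩) (fun k => ⟨k, sl _ h.symm⟩)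
    have o₁ := isMinVC_or_erase H₁ _ x₁ c₁ (by
      rintro v ⟨hv, hvs⟩ hvx
      obtain ⟨w, hw, hwD⟩ := hp v hv
      rcases (hadj v w).1 hw with h | h | ⟨h, -⟩ | ⟨h, -⟩
      · exact ⟨w, h, fun k => hwD k.1⟩
      · exact (hd v hvs (sl _ h)).elim
      · exact (hvx h).elim
      · exact (hd v hvs (h ▸ hx₂)).elim)
    have o₂ := isMinVC_or_erase H₂ _ x₂ c₂ (by
      rintro v ⟨hv, hvs⟩ hvx
      obtain ⟨w, hw, hwD⟩ := hp v hv
      rcases (hadj v w).1 hw with h | h | ⟨h, -⟩ | ⟨h, -⟩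
      · exact (hd v (sl _ h) hvs).elim
      · exact ⟨w, h, fun k => hwD k.1⟩
      · exact (hd v (h ▸ hx₁) hvs).elim
      · exact (hvx h).elim)
    have key : ∀ C, IsMinVC H₁ C → x₁ ∉ C → C.ncard < D₁.ncard := by
      intro C hC hx
      refine lt_of_le_of_ne (hM₁ C hC) fun he => hx (h₁ C ⟨hC, fun E hE => ?_⟩)
      rw [he]
      exact hM₁ E hE
    have n₁ : x₁ ∈ D → (∀ w, H₁.Adj x₁ w → w ∈ D ∩ H₁.support) → x₂ ∉ D := by
      intro hx hall
      obtain ⟨w, hw, hwD⟩ := hp _ hx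
      rcases (hadj _ w).1 hw with h | h | ⟨-, h⟩ | ⟨h, -⟩
      · exact (hwD (hall w h).1).elim
      · exact (hd _ hx₁ (sl _ h)).elim
      · exact h ▸ hwD
      · exact (hne h).elim
    have n₂ : x₂ ∈ D → (∀ w, H₂.Adj x₂ w → w ∈ D ∩ H₂.support) → x₁ ∉ D := by
      intro hx hall
      obtain ⟨w, hw, hwD⟩ := hp _ hx
      rcases (hadj _ w).1 hw with h | h | ⟨h, -⟩ | ⟨-, h⟩
      · exact (hd _ (sl _ h) hx₂).elim
      · exact (hwD (hall w h).1).elim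
      · exact (hne h.symm).elim
      · exact h ▸ hwD
    rw [hcard]
    rcases o₁ with o₁ | ⟨a₁, b₁, o₁⟩
    · rcases o₂ with o₂ | ⟨a₂, b₂, o₂⟩
      · exact add_le_add (hM₁ _ o₁) (hM₂ _ o₂)
      · have k := key _ o₁ fun h => n₂ a₂.1 b₂ h.1
        have e := Set.ncard_diff_singleton_add_one a₂ (Set.toFinite _)
        have m := hM₂ _ o₂
        omega
    · have k := key _ o₁ fun h => h.2 rfl
      have e := Set.ncard_diff_singleton_add_one a₁ (Set.toFinite _)
      rcases o₂ with o₂ | ⟨a₂, b₂, o₂⟩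
      · have m := hM₂ _ o₂
        omega
      · exact (n₁ a₁.1 b₁ a₂.1).elim
end

section
/- Let G be a finite simple graph, x a vertex of G, and C a minimal vertex cover of G with x ∉ C. Then a neighbour y of x is redundant with respect to C if and only if C∖{y} is a minimal vertex cover of G∖{xy}. Moreover, if C contains a redundant neighbour of x, then C ∪ {x} is not a minimal vertex cover of G. -/
open SimpleGraph

variable {V : Type}

/-- A neighbour `y` of `x` in `G` is free if it does not lie on a cycle
through `x`. -/
def FreeNbr (G : SimpleGraph V) (x y : V) : Prop :=
  G.Adj x y ∧ ∀ c : G.Walk x x, c.IsCycle → y ∉ c.support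

/-- Given a minimal vertex cover `C` of `G` with `x ∉ C`, a neighbour `y` of
`x` is redundant with respect to `C` if `y ∈ C` and all neighbours of `y`
other than `x` belong to `C`. -/
def RedundantNbr (G : SimpleGraph V) (C : Set V) (x y : V) : Prop :=
  G.Adj x y ∧ y ∈ C ∧ ∀ z : V, G.Adj y z → z ≠ x → z ∈ C

/-- Let `C` be a minimal vertex cover of `G` with `x ∉ C`. A neighbour `y` of
`x` is redundant with respect to `C` iff `C ∖ {y}` is a minimal vertex cover
of `G ∖ {xy}`. Moreover, if `C` contains a redundant neighbour of `x`, then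
`C ∪ {x}` is not a minimal vertex cover of `G`. -/
theorem stmt11 {V : Type} [Fintype V] (G : SimpleGraph V) (x : V)
    (C : Set V) (hC : IsMinVC G C) (hx : x ∉ C) :
    (∀ y : V, G.Adj x y →
      (RedundantNbr G C x y ↔ IsMinVC (G.deleteEdges {s(x, y)}) (C \ {y}))) ∧
    ((∃ y : V, RedundantNbr G C x y) → ¬ IsMinVC G (C ∪ {x})) := by
  refine ⟨fun y hxy => ⟨fun h => ⟨?_, ?_⟩, fun h => ⟨hxy, ?_, ?_⟩⟩, ?_⟩
  · intro u v huv
    rw [SimpleGraph.deleteEdges_adj] at huv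
    obtain ⟨huv, hne⟩ := huv
    have h0 := huv.ne
    simp only [Set.mem_singleton_iff, Sym2.eq_iff] at hne
    obtain ⟨_, hy, hz⟩ := h
    simp only [Set.mem_diff, Set.mem_singleton_iff]
    by_cases hu : u = y
    · subst hu
      exact Or.inr ⟨hz v huv (fun e => hne (Or.inr ⟨rfl, e⟩)), fun e => h0 e.symm⟩
    · by_cases hv : v = y
      · subst hv
        exact Or.inl ⟨hz u huv.symm (fun e => hne (Or.inl ⟨e, rfl⟩)), h0⟩
      · rcases hC.1 huv with h1 | h1
        · exact Or.inl ⟨h1, hu⟩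
        · exact Or.inr ⟨h1, hv⟩
  · intro D hD hcov
    obtain ⟨hsub, hns⟩ := hD
    refine hC.2 (D ∪ {y}) ⟨?_, ?_⟩ ?_
    · rintro z (hz | hz)
      · exact (hsub hz).1
      · rw [Set.mem_singleton_iff.1 hz]
        exact h.2.1
    · intro hCD
      apply hns
      rintro z ⟨hz, hzy⟩
      exact (hCD hz).resolve_right hzy
    · intro u v huv
      by_cases hu : u = y
      · exact Or.inl (Or.inr hu)
      · by_cases hv : v = y
        · exact Or.inr (Or.inr hv)
        · have : (G.deleteEdges {s(x, y)}).Adj u v := by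
            rw [SimpleGraph.deleteEdges_adj]
            refine ⟨huv, ?_⟩
            simp only [Set.mem_singleton_iff, Sym2.eq_iff]
            rintro (⟨_, e⟩ | ⟨e, _⟩)
            · exact hv e
            · exact hu e
          exact (hcov this).imp Or.inl Or.inl
  · exact (hC.1 hxy).resolve_left hx
  · intro z hyz hzx
    have : (G.deleteEdges {s(x, y)}).Adj y z := by
      rw [SimpleGraph.deleteEdges_adj]
      refine ⟨hyz, ?_⟩
      simp only [Set.mem_singleton_iff, Sym2.eq_iff]
      rintro (⟨e, _⟩ | ⟨_, e⟩)
      · exact hxy.ne e.symm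
      · exact hzx e
    rcases h.1 this with h1 | h1
    · exact absurd rfl h1.2
    · exact h1.1
  · rintro - hm
    exact hm.2 C ⟨Set.subset_union_left, fun h => hx (h (Or.inr rfl))⟩ hC.1
end

section
/- Let G be a connected finite simple graph whose cycles are pairwise vertex-disjoint, and suppose that every edge of G that does not belong to a cycle is terminal (incident to a leaf). Then G has at most one cycle. -/
open SimpleGraph

variable {V : Type}

/-- The cycles of `G` are pairwise vertex-disjoint: any two cycles sharing a
vertex have the same edge set (i.e. are the same cycle). -/
def CyclesPairwiseDisjoint (G : SimpleGraph V) : Prop :=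
  ∀ ⦃u v : V⦄ (c : G.Walk u u) (d : G.Walk v v), c.IsCycle → d.IsCycle →
    (∃ w : V, w ∈ c.support ∧ w ∈ d.support) →
    ∀ e : Sym2 V, e ∈ c.edges ↔ e ∈ d.edges

/-- If `G` is a connected graph with pairwise vertex-disjoint cycles in which
every edge not belonging to a cycle is terminal, then `G` has at most one
cycle: any two cycles of `G` have the same edge set. -/
theorem stmt17 {V : Type} [Fintype V] (G : SimpleGraph V)
    (hconn : G.Connected)
    (hcyc : CyclesPairwiseDisjoint G)
    (hterm : ∀ ⦃u v : V⦄, G.Adj u v →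
      (∀ (w : V) (c : G.Walk w w), c.IsCycle → s(u, v) ∉ c.edges) →
      G.neighborSet u = {v} ∨ G.neighborSet v = {u}) :
    ∀ ⦃u v : V⦄ (c : G.Walk u u) (d : G.Walk v v), c.IsCycle → d.IsCycle →
      ∀ e : Sym2 V, e ∈ c.edges ↔ e ∈ d.edges := by
  intro u v c d hc hd
  classical
  have key : ∀ (a b : V) (p : G.Walk a b),
      (a ∈ c.support ∨ ∃ y ∈ c.support, G.neighborSet a = {y}) →
      (b ∈ c.support ∨ ∃ y ∈ c.support, G.neighborSet b = {y}) := by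
    intro a b p
    induction p with
    | nil => exact id
    | @cons x z w h p ih =>
      intro hx
      apply ih
      rcases hx with hx | ⟨y, hy, hN⟩
      · by_cases hcy : ∀ (w : V) (c : G.Walk w w), c.IsCycle → s(x, z) ∉ c.edges
        · rcases hterm h hcy with h1 | h1
          · left
            obtain ⟨e, he, hxe⟩ := (Walk.mem_support_iff_exists_mem_edges_of_not_nil
              hc.not_nil).1 hx
            obtain ⟨t, rfl⟩ := Sym2.mem_iff_exists.1 hxe
            have ht : t ∈ G.neighborSet x := c.adj_of_mem_edges he
            rw [h1] at ht
            have ht' : t = z := ht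
            subst ht'
            exact c.snd_mem_support_of_mem_edges he
          · exact Or.inr ⟨x, hx, h1⟩
        · push Not at hcy
          obtain ⟨w, f, hf, hfe⟩ := hcy
          have := (hcyc c f hc hf ⟨x, hx, f.fst_mem_support_of_mem_edges hfe⟩ s(x, z)).2 hfe
          exact Or.inl (c.snd_mem_support_of_mem_edges this)
      · left
        have hz : z ∈ G.neighborSet x := h
        rw [hN] at hz
        have hz' : z = y := hz
        exact hz' ▸ hy
  obtain ⟨p⟩ := hconn.preconnected u v
  rcases key u v p (Or.inl c.start_mem_support) with h | ⟨y, hy, hN⟩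
  · exact hcyc c d hc hd ⟨v, h, d.start_mem_support⟩
  · have h1 : d.snd ∈ G.neighborSet v := d.adj_snd hd.not_nil
    rw [hN] at h1
    have h2 : d.snd = y := h1
    exact hcyc c d hc hd ⟨y, hy, h2 ▸ d.getVert_mem_support 1⟩
end
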